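/- Multiplicativity of the superdeterminant: Let M and N be even (m|n) supermatrices over Λ whose diagonal blocks (the m×m block and the n×n block, with entries in Λ_ev) are invertible over Λ_ev. Then the diagonal blocks of the product MN are invertible over Λ_ev and sdet(MN) = sdet(M)·sdet(N). -/

import Mathlib

set_option synthInstance.maxHeartbeats 1000000
set_option maxHeartbeats 2000000

noncomputable section

/-- `Λ`: the (complexified) Grassmann algebra on `L` generators. -/
abbrev Lam (L : ℕ) : Type := ExteriorAlgebra ℂ (Fin L → ℂ)

variable (L : ℕ)

/-- The even part `Λ_ev`. -/
def evenPart : Submodule ℂ (Lam L) :=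
  CliffordAlgebra.evenOdd (0 : QuadraticForm ℂ (Fin L → ℂ)) 0

/-- The odd part `Λ_od`. -/
def oddPart : Submodule ℂ (Lam L) :=
  CliffordAlgebra.evenOdd (0 : QuadraticForm ℂ (Fin L → ℂ)) 1

/-- Determinant of a square matrix with entries in `Λ` (intended for matrices whose entries
are even, hence central), as the signed sum over permutations of ordered products. -/
def detE {k : ℕ} (M : Matrix (Fin k) (Fin k) (Lam L)) : Lam L :=
  ∑ σ : Equiv.Perm (Fin k), (Equiv.Perm.sign σ : ℤ) • (List.ofFn fun i => M (σ i) i).prod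

namespace Superdeterminant

open Matrix

section Abstract

variable {E Λ m n : Type*} [CommRing E] [Ring Λ] [Algebra E Λ]
  [Fintype m] [DecidableEq m] [Fintype n] [DecidableEq n]

/-- The properties of the odd part of a supercommutative ring `Λ` over its even part `E`. -/
structure IsOddPart (E : Type*) {Λ : Type*} [CommRing E] [Ring Λ] [Algebra E Λ]
    (O : AddSubgroup Λ) : Prop where
  injective : Function.Injective (algebraMap E Λ)
  even_mul_mem : ∀ (e : E) {x : Λ}, x ∈ O → algebraMap E Λ e * x ∈ O
  mul_mem_range : ∀ {x y : Λ}, x ∈ O → y ∈ O → ∃ e : E, algebraMap E Λ e = x * y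
  mul_eq_neg_mul : ∀ {x y : Λ}, x ∈ O → y ∈ O → x * y = -(y * x)
  mul_self : ∀ {x : Λ}, x ∈ O → x * x = 0

/-- Extension of scalars of a square matrix from the even part to the whole ring. -/
abbrev coeMat (E Λ : Type*) {m : Type*} [CommRing E] [Ring Λ] [Algebra E Λ]
    [Fintype m] [DecidableEq m] : Matrix m m E →+* Matrix m m Λ :=
  (algebraMap E Λ).mapMatrix

theorem exists_coeMat_eq {M : Matrix m m Λ}
    (h : ∀ i j, ∃ e : E, algebraMap E Λ e = M i j) : ∃ P, coeMat E Λ P = M := by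
  choose f hf using h
  exact ⟨Matrix.of f, by ext i j; simp [hf]⟩

variable {O : AddSubgroup Λ}

theorem IsOddPart.coeMat_injective (hO : IsOddPart E O) :
    Function.Injective (coeMat E Λ (m := m)) :=
  Matrix.map_injective hO.injective

omit [DecidableEq n] in
theorem IsOddPart.exists_coeMat_eq_mul (hO : IsOddPart E O) {X : Matrix m n Λ}
    {Y : Matrix n m Λ} (hX : ∀ i j, X i j ∈ O) (hY : ∀ i j, Y i j ∈ O) :
    ∃ P, coeMat E Λ P = X * Y := by
  refine exists_coeMat_eq fun i j => ?_
  choose f hf using fun k => hO.mul_mem_range (hX i k) (hY k j)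
  exact ⟨∑ k, f k, by simp [Matrix.mul_apply, hf]⟩

omit [Fintype n] [DecidableEq n] in
theorem IsOddPart.coeMat_mul_mem (hO : IsOddPart E O) (R : Matrix m m E) {X : Matrix m n Λ}
    (hX : ∀ i j, X i j ∈ O) (i : m) (j : n) : (coeMat E Λ R * X) i j ∈ O := by
  rw [Matrix.mul_apply]
  exact sum_mem fun k _ => hO.even_mul_mem _ (hX k j)

omit [Fintype m] [DecidableEq m] in
theorem IsOddPart.mul_coeMat_mem (hO : IsOddPart E O) (R : Matrix n n E) {X : Matrix m n Λ}
    (hX : ∀ i j, X i j ∈ O) (i : m) (j : n) : (X * coeMat E Λ R) i j ∈ O := by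
  rw [Matrix.mul_apply]
  refine sum_mem fun k _ => ?_
  have := hO.even_mul_mem (R k j) (hX i k)
  rwa [Algebra.commutes] at this

/-- The relation `det (1 + X * Y) * det (1 + Y * X) = 1`, where the determinants are those of the
lifts of the matrices to the even part. -/
def DetMulDetEqOne (E : Type*) {Λ m n : Type*} [CommRing E] [Ring Λ] [Algebra E Λ]
    [Fintype m] [DecidableEq m] [Fintype n] [DecidableEq n]
    (X : Matrix m n Λ) (Y : Matrix n m Λ) : Prop :=
  ∀ (P : Matrix m m E) (Q : Matrix n n E), coeMat E Λ P = X * Y → coeMat E Λ Q = Y * X →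
    (1 + P).det * (1 + Q).det = 1

theorem DetMulDetEqOne.symm {X : Matrix m n Λ} {Y : Matrix n m Λ}
    (h : DetMulDetEqOne E X Y) : DetMulDetEqOne E Y X :=
  fun P Q hP hQ => by rw [mul_comm]; exact h Q P hQ hP

theorem IsOddPart.detMulDetEqOne_add (hO : IsOddPart E O) {X X' : Matrix m n Λ}
    {Y : Matrix n m Λ} (hX : ∀ i j, X i j ∈ O) (hX' : ∀ i j, X' i j ∈ O)
    (hY : ∀ i j, Y i j ∈ O) (h : DetMulDetEqOne E X Y)
    (h' : ∀ R : Matrix m m E, DetMulDetEqOne E (coeMat E Λ R * X') Y) :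
    DetMulDetEqOne E (X + X') Y := by
  intro P Q hP hQ
  obtain ⟨P₀, hP₀⟩ := hO.exists_coeMat_eq_mul hX hY
  obtain ⟨Q₀, hQ₀⟩ := hO.exists_coeMat_eq_mul hY hX
  have h₀ := h P₀ Q₀ hP₀ hQ₀
  have hu : IsUnit (1 + P₀).det := IsUnit.of_mul_eq_one _ h₀
  set R := (1 + P₀)⁻¹
  have hR : (1 + P₀) * R = 1 := Matrix.mul_nonsing_inv _ hu
  obtain ⟨Q₁, hQ₁⟩ := hO.exists_coeMat_eq_mul hY (hO.coeMat_mul_mem R hX')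
  have h₁ := h' R (R * (P - P₀)) Q₁
    (by rw [map_mul, map_sub, hP, hP₀, Matrix.add_mul, add_sub_cancel_left, Matrix.mul_assoc]) hQ₁
  have eP : 1 + P = (1 + P₀) * (1 + R * (P - P₀)) := by
    rw [mul_add, ← mul_assoc, hR]; noncomm_ring
  have eQ : 1 + Q = (1 + Q₀) * (1 + Q₁) := by
    apply hO.coeMat_injective
    have e : X * (Y * (coeMat E Λ R * X')) = X' - coeMat E Λ R * X' := by
      have := congrArg (coeMat E Λ) hR
      rw [map_mul, map_add, map_one, hP₀, add_mul, one_mul] at this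
      rw [← Matrix.mul_assoc, ← Matrix.mul_assoc, eq_sub_of_add_eq' this, Matrix.sub_mul,
        Matrix.one_mul]
    rw [map_mul, map_add, map_add, map_add, map_one, hQ, hQ₀, hQ₁, mul_add, mul_one, add_mul,
      one_mul, Matrix.mul_assoc Y X, e, Matrix.mul_sub, Matrix.mul_add]
    abel
  rw [eP, eQ, det_mul, det_mul]
  linear_combination h₀ * (1 + R * (P - P₀)).det * (1 + Q₁).det + h₁

theorem IsOddPart.detMulDetEqOne_of_columns (hO : IsOddPart E O) {Y : Matrix n m Λ}
    (hY : ∀ i j, Y i j ∈ O)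
    (h : ∀ (j : n) (X : Matrix m n Λ), (∀ i k, X i k ∈ O) → (∀ i k, k ≠ j → X i k = 0) →
      DetMulDetEqOne E X Y)
    {X : Matrix m n Λ} (hX : ∀ i j, X i j ∈ O) : DetMulDetEqOne E X Y := by
  suffices H : ∀ (s : Finset n) (X : Matrix m n Λ), (∀ i k, X i k ∈ O) →
      (∀ i k, k ∉ s → X i k = 0) → DetMulDetEqOne E X Y from
    H Finset.univ X hX fun i k hk => absurd (Finset.mem_univ k) hk
  intro s
  induction s using Finset.induction_on with
  | empty =>
    intro X _ hX₀ P Q hP hQ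
    obtain rfl : X = 0 := by ext i k; exact hX₀ i k (Finset.notMem_empty k)
    rw [Matrix.zero_mul, map_eq_zero_iff _ hO.coeMat_injective] at hP
    rw [Matrix.mul_zero, map_eq_zero_iff _ hO.coeMat_injective] at hQ
    simp [hP, hQ]
  | insert j s _ ih =>
    intro X hX hXs
    have hsplit : X = Matrix.of (fun i k => if k = j then 0 else X i k)
        + Matrix.of (fun i k => if k = j then X i k else 0) := by
      ext i k
      by_cases hk : k = j <;> simp [hk]
    have hX' : ∀ i k, Matrix.of (fun i k => if k = j then X i k else 0) i k ∈ O := by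
      intro i k
      by_cases hk : k = j <;> simp [hk, hX]
    have hX₀ : ∀ i k, Matrix.of (fun i k => if k = j then 0 else X i k) i k ∈ O := by
      intro i k
      by_cases hk : k = j <;> simp [hk, hX]
    rw [hsplit]
    refine hO.detMulDetEqOne_add hX₀ hX' hY (ih _ hX₀ fun i k hk => ?_) fun R =>
      h j _ (hO.coeMat_mul_mem R hX') fun i k hk => ?_
    · by_cases hkj : k = j
      · simp [hkj]
      · simp [hkj, hXs i k (by simp [hkj, hk])]
    · simp [Matrix.mul_apply, hk]

omit [DecidableEq n] [Fintype n] in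
theorem det_one_add_of_column {P : Matrix m m E} {k : m} (hP : ∀ i j, j ≠ k → P i j = 0) :
    (1 + P).det = 1 + P k k := by
  have h : 1 + P = (1 : Matrix m m E).updateCol k (fun i => (1 + P) i k) := by
    ext i j
    by_cases hj : j = k
    · subst hj; simp
    · simp [Matrix.updateCol_ne hj, hP i j hj]
  rw [h, ← Matrix.cramer_apply, Matrix.cramer_one]
  simp

theorem IsOddPart.detMulDetEqOne_of_column_of_column (hO : IsOddPart E O) {X : Matrix m n Λ}
    {Y : Matrix n m Λ} (hX : ∀ i j, X i j ∈ O) (hY : ∀ i j, Y i j ∈ O) {j : n} {k : m}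
    (hXj : ∀ a b, b ≠ j → X a b = 0) (hYk : ∀ a b, b ≠ k → Y a b = 0) :
    DetMulDetEqOne E X Y := by
  intro P Q hP hQ
  have eP : ∀ a b, algebraMap E Λ (P a b) = X a j * Y j b := fun a b => by
    have := congrFun₂ hP a b
    rwa [Matrix.mul_apply, Finset.sum_eq_single j (fun c _ hc => by simp [hXj a c hc])
      (by simp)] at this
  have eQ : ∀ a b, algebraMap E Λ (Q a b) = Y a k * X k b := fun a b => by
    have := congrFun₂ hQ a b
    rwa [Matrix.mul_apply, Finset.sum_eq_single k (fun c _ hc => by simp [hYk a c hc])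
      (by simp)] at this
  have hPk : ∀ a b, b ≠ k → P a b = 0 := fun a b hb =>
    hO.injective (by rw [eP, hYk j b hb, mul_zero, map_zero])
  have hQj : ∀ a b, b ≠ j → Q a b = 0 := fun a b hb =>
    hO.injective (by rw [eQ, hXj k b hb, mul_zero, map_zero])
  rw [det_one_add_of_column hPk, det_one_add_of_column hQj]
  have h₁ : Q j j = -P k k := hO.injective (by
    rw [map_neg, eP, eQ, hO.mul_eq_neg_mul (hY j k) (hX k j)])
  have h₂ : P k k * P k k = 0 := hO.injective (by
    rw [map_mul, eP, map_zero]
    conv_lhs => rw [mul_assoc, ← mul_assoc (Y j k), hO.mul_eq_neg_mul (hY j k) (hX k j)]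
    rw [neg_mul, mul_assoc, hO.mul_self (hY j k)]
    simp)
  rw [h₁]
  linear_combination -h₂

theorem IsOddPart.detMulDetEqOne (hO : IsOddPart E O) {X : Matrix m n Λ}
    {Y : Matrix n m Λ} (hX : ∀ i j, X i j ∈ O) (hY : ∀ i j, Y i j ∈ O) :
    DetMulDetEqOne E X Y :=
  hO.detMulDetEqOne_of_columns hY (fun _ _ hX hXj =>
    (hO.detMulDetEqOne_of_columns hX
      (fun _ _ hY hYk => (hO.detMulDetEqOne_of_column_of_column hX hY hXj hYk).symm) hY).symm) hX

theorem IsOddPart.exists_inverse_add (hO : IsOddPart E O) {A₁ A₁' A₂ A₂' : Matrix m m E}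
    {C : Matrix m n Λ} {D : Matrix n m Λ} (hC : ∀ i j, C i j ∈ O) (hD : ∀ i j, D i j ∈ O)
    (h₁ : A₁ * A₁' = 1) (h₂ : A₂ * A₂' = 1) :
    ∃ P : Matrix m m E, (coeMat E Λ A₁ * coeMat E Λ A₂ + C * D) * coeMat E Λ P = 1 ∧
      coeMat E Λ P * (coeMat E Λ A₁ * coeMat E Λ A₂ + C * D) = 1 := by
  have hX := hO.coeMat_mul_mem A₁' hC
  have hY := hO.mul_coeMat_mem A₂' hD
  obtain ⟨P, hP⟩ := hO.exists_coeMat_eq_mul hX hY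
  obtain ⟨Q, hQ⟩ := hO.exists_coeMat_eq_mul hY hX
  have hu : IsUnit (1 + P).det := IsUnit.of_mul_eq_one _ (hO.detMulDetEqOne hX hY P Q hP hQ)
  have e : coeMat E Λ A₁ * coeMat E Λ A₂ + C * D = coeMat E Λ (A₁ * (1 + P) * A₂) := by
    have h₁' := congrArg (coeMat E Λ) h₁
    have h₂' := congrArg (coeMat E Λ) (mul_eq_one_comm.mp h₂)
    rw [map_mul, map_one] at h₁' h₂'
    rw [map_mul, map_mul, map_add, map_one, hP, mul_add, add_mul, mul_one]
    congr 1
    rw [← Matrix.mul_assoc, ← Matrix.mul_assoc, ← Matrix.mul_assoc, h₁', Matrix.one_mul,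
      Matrix.mul_assoc, h₂', Matrix.mul_one]
  have hdet : IsUnit (A₁ * (1 + P) * A₂).det := by
    rw [det_mul, det_mul]
    exact ((Matrix.isUnit_det_of_right_inverse h₁).mul hu).mul
      (Matrix.isUnit_det_of_right_inverse h₂)
  refine ⟨(A₁ * (1 + P) * A₂)⁻¹, ?_, ?_⟩
  · rw [e, ← map_mul, Matrix.mul_nonsing_inv _ hdet, map_one]
  · rw [e, ← map_mul, Matrix.nonsing_inv_mul _ hdet, map_one]

omit [DecidableEq n] in
/-- Factorization of the Schur complement of a product of two block matrices. -/
theorem schur_complement_mul (X : Matrix m n Λ) (Y : Matrix n m Λ) (R : Matrix m m Λ)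
    (B₁ B₂ : Matrix n n Λ) (C : Matrix m n Λ) (D : Matrix n m Λ)
    (hR : (1 + X * Y) * R = 1) (hR' : R * (1 + X * Y) = 1) :
    D * C + B₁ * B₂ - (D + B₁ * Y) * R * (C + X * B₂)
      = (B₁ - D * X) * (B₂ - Y * C) - (B₁ - D * X) * (Y * R * X) * (B₂ - Y * C) := by
  have e : X * (Y * R) = 1 - R := by
    rw [← Matrix.mul_assoc]; exact eq_sub_of_add_eq' (by rwa [add_mul, one_mul] at hR)
  have e' : R * (X * Y) = 1 - R := eq_sub_of_add_eq' (by rwa [mul_add, mul_one] at hR')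
  have f : ∀ Z : Matrix m n Λ, X * (Y * (R * Z)) = Z - R * Z := fun Z => by
    rw [← Matrix.mul_assoc Y, ← Matrix.mul_assoc, e, Matrix.sub_mul, Matrix.one_mul]
  have f' : ∀ Z : Matrix m n Λ, R * (X * (Y * Z)) = Z - R * Z := fun Z => by
    rw [← Matrix.mul_assoc X, ← Matrix.mul_assoc, e', Matrix.sub_mul, Matrix.one_mul]
  simp only [Matrix.mul_add, Matrix.add_mul, Matrix.mul_sub, Matrix.sub_mul, Matrix.mul_assoc,
    f, f']
  abel

theorem IsOddPart.exists_det_eq (hO : IsOddPart E O) {A₁ A₁' A₂ A₂' : Matrix m m E}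
    {B₁ B₂ : Matrix n n E} {C₁ C₂ : Matrix m n Λ} {D₁ D₂ : Matrix n m Λ}
    (hC₁ : ∀ i j, C₁ i j ∈ O) (hD₁ : ∀ i j, D₁ i j ∈ O)
    (hC₂ : ∀ i j, C₂ i j ∈ O) (hD₂ : ∀ i j, D₂ i j ∈ O)
    (h₁ : A₁ * A₁' = 1) (h₂ : A₂ * A₂' = 1) {A₃' : Matrix m m Λ}
    (h₃ : (coeMat E Λ A₁ * coeMat E Λ A₂ + C₁ * D₂) * A₃' = 1) :
    ∃ (A₃ : Matrix m m E) (S₁ S₂ S₃ : Matrix n n E) (r : E),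
      coeMat E Λ A₃ = coeMat E Λ A₁ * coeMat E Λ A₂ + C₁ * D₂ ∧
      coeMat E Λ S₁ = coeMat E Λ B₁ - D₁ * coeMat E Λ A₁' * C₁ ∧
      coeMat E Λ S₂ = coeMat E Λ B₂ - D₂ * coeMat E Λ A₂' * C₂ ∧
      coeMat E Λ S₃ = (D₁ * C₂ + coeMat E Λ B₁ * coeMat E Λ B₂)
        - (D₁ * coeMat E Λ A₂ + coeMat E Λ B₁ * D₂) * A₃' *
          (coeMat E Λ A₁ * C₂ + C₁ * coeMat E Λ B₂) ∧
      A₃.det = A₁.det * r * A₂.det ∧ S₃.det = S₁.det * r * S₂.det := by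
  have hX := hO.coeMat_mul_mem A₁' hC₁
  have hY := hO.mul_coeMat_mem A₂' hD₂
  obtain ⟨P, hP⟩ := hO.exists_coeMat_eq_mul hX hY
  obtain ⟨Q, hQ⟩ := hO.exists_coeMat_eq_mul hY hX
  have hdet := hO.detMulDetEqOne hX hY P Q hP hQ
  have hu : IsUnit (1 + P).det := IsUnit.of_mul_eq_one _ hdet
  obtain ⟨R, hR, hR'⟩ : ∃ R, (1 + P) * R = 1 ∧ R * (1 + P) = 1 :=
    ⟨_, Matrix.mul_nonsing_inv _ hu, Matrix.nonsing_inv_mul _ hu⟩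
  obtain ⟨U₁, hU₁⟩ := hO.exists_coeMat_eq_mul hD₁ hX
  obtain ⟨U₂, hU₂⟩ := hO.exists_coeMat_eq_mul hY hC₂
  obtain ⟨V, hV⟩ := hO.exists_coeMat_eq_mul (hO.mul_coeMat_mem R hY) hX
  have coe_one : ∀ {M N : Matrix m m E}, M * N = 1 → coeMat E Λ M * coeMat E Λ N = 1 :=
    fun h => by rw [← map_mul, h, map_one]
  have k₁ := coe_one h₁
  have k₁' := coe_one (mul_eq_one_comm.mp h₁)
  have k₂ := coe_one h₂
  have k₂' := coe_one (mul_eq_one_comm.mp h₂)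
  have kR := coe_one hR
  have kR' := coe_one hR'
  rw [map_add, map_one, hP] at kR kR'
  have eA : coeMat E Λ (A₁ * (1 + P) * A₂) = coeMat E Λ A₁ * coeMat E Λ A₂ + C₁ * D₂ := by
    rw [map_mul, map_mul, map_add, map_one, hP, mul_add, add_mul, mul_one]
    congr 1
    rw [← Matrix.mul_assoc, ← Matrix.mul_assoc, ← Matrix.mul_assoc, k₁, Matrix.one_mul,
      Matrix.mul_assoc, k₂', Matrix.mul_one]
  have eA' : A₃' = coeMat E Λ (A₂' * R * A₁') := by
    refine (left_inv_eq_right_inv ?_ h₃).symm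
    rw [← eA, ← map_mul, ← map_one (coeMat E Λ)]
    congr 1
    calc A₂' * R * A₁' * (A₁ * (1 + P) * A₂)
        = A₂' * (R * ((A₁' * A₁) * (1 + P))) * A₂ := by noncomm_ring
      _ = 1 := by rw [mul_eq_one_comm.mp h₁, one_mul, hR', mul_one, mul_eq_one_comm.mp h₂]
  have hT : (1 + Q) * (1 - V) = 1 := by
    apply hO.coeMat_injective
    rw [map_mul, map_add, map_sub, map_one, hQ, hV]
    generalize coeMat E Λ A₁' * C₁ = X at *
    generalize D₂ * coeMat E Λ A₂' = Y at *
    have e : X * (Y * coeMat E Λ R) = 1 - coeMat E Λ R := by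
      rw [← Matrix.mul_assoc]; exact eq_sub_of_add_eq' (by rwa [add_mul, one_mul] at kR)
    rw [mul_sub, mul_one, add_mul, one_mul, Matrix.mul_assoc Y X, ← Matrix.mul_assoc X, e,
      Matrix.sub_mul, Matrix.mul_sub, Matrix.one_mul, Matrix.mul_assoc]
    abel
  have hr : (1 - V).det = (1 + P).det := by
    have := congrArg Matrix.det hT
    rw [det_mul, det_one] at this
    linear_combination (1 + P).det * this - (1 - V).det * hdet
  refine ⟨A₁ * (1 + P) * A₂, B₁ - U₁, B₂ - U₂, (B₁ - U₁) * (1 - V) * (B₂ - U₂), (1 + P).det,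
    eA, ?_, ?_, ?_, ?_, ?_⟩
  · rw [map_sub, hU₁, Matrix.mul_assoc]
  · rw [map_sub, hU₂]
  · have eD : D₁ * coeMat E Λ A₂ + coeMat E Λ B₁ * D₂
        = (D₁ + coeMat E Λ B₁ * (D₂ * coeMat E Λ A₂')) * coeMat E Λ A₂ := by
      rw [Matrix.add_mul, Matrix.mul_assoc, Matrix.mul_assoc D₂, k₂', Matrix.mul_one]
    have eC : coeMat E Λ A₁ * C₂ + C₁ * coeMat E Λ B₂
        = coeMat E Λ A₁ * (C₂ + coeMat E Λ A₁' * C₁ * coeMat E Λ B₂) := by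
      rw [Matrix.mul_add, ← Matrix.mul_assoc _ (coeMat E Λ A₁' * C₁), ← Matrix.mul_assoc _ _ C₁,
        k₁, Matrix.one_mul]
    have eM : ∀ (Z : Matrix n m Λ) (W : Matrix m n Λ),
        Z * coeMat E Λ A₂ * A₃' * (coeMat E Λ A₁ * W) = Z * coeMat E Λ R * W := by
      intro Z W
      rw [eA', map_mul, map_mul]
      calc _ = Z * ((coeMat E Λ A₂ * coeMat E Λ A₂') * coeMat E Λ R *
            (coeMat E Λ A₁' * coeMat E Λ A₁)) * W := by simp only [Matrix.mul_assoc]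
        _ = _ := by rw [k₁', k₂, one_mul, mul_one]
    rw [eD, eC, eM, schur_complement_mul _ _ _ _ _ _ _ kR kR', map_mul, map_mul, map_sub, map_sub,
      map_sub, map_one, hU₁, hU₂, hV, mul_sub _ 1, mul_one, sub_mul]
  · rw [det_mul, det_mul]
  · rw [det_mul, det_mul, hr]

end Abstract

section Grassmann

open CliffordAlgebra in
theorem ι_mul_of_mem_evenPart (v : Fin L → ℂ) {x : Lam L} (hx : x ∈ evenPart L) :
    ExteriorAlgebra.ι ℂ v * x = x * ExteriorAlgebra.ι ℂ v := by
  refine even_induction (0 : QuadraticForm ℂ (Fin L → ℂ))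
    (motive := fun x _ => ExteriorAlgebra.ι ℂ v * x = x * ExteriorAlgebra.ι ℂ v)
    (fun r => (Algebra.commutes r _).symm) (fun x y _ _ hx hy => by rw [mul_add, add_mul, hx, hy])
    (fun a b x _ hx => ?_) x hx
  have ha := eq_neg_of_add_eq_zero_left (ExteriorAlgebra.ι_add_mul_swap (R := ℂ) v a)
  have hb := eq_neg_of_add_eq_zero_left (ExteriorAlgebra.ι_add_mul_swap (R := ℂ) v b)
  change ExteriorAlgebra.ι ℂ v * (ExteriorAlgebra.ι ℂ a * ExteriorAlgebra.ι ℂ b * x)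
    = ExteriorAlgebra.ι ℂ a * ExteriorAlgebra.ι ℂ b * x * ExteriorAlgebra.ι ℂ v
  rw [mul_assoc _ x, ← hx, ← mul_assoc, ← mul_assoc, ha, neg_mul, mul_assoc _ _ (_ : Lam L),
    hb, mul_neg, neg_neg]
  simp only [mul_assoc]

theorem commute_of_mem_evenPart {x : Lam L} (hx : x ∈ evenPart L) (y : Lam L) :
    x * y = y * x := by
  induction y using ExteriorAlgebra.induction with
  | algebraMap r => exact (Algebra.commutes r x).symm
  | ι v => exact (ι_mul_of_mem_evenPart L v hx).symm
  | mul a b ha hb => rw [← mul_assoc, ha, mul_assoc, hb, mul_assoc]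
  | add a b ha hb => rw [mul_add, add_mul, ha, hb]

open CliffordAlgebra in
theorem ι_mul_of_mem_oddPart (v : Fin L → ℂ) {x : Lam L} (hx : x ∈ oddPart L) :
    ExteriorAlgebra.ι ℂ v * x = -(x * ExteriorAlgebra.ι ℂ v) := by
  refine odd_induction (0 : QuadraticForm ℂ (Fin L → ℂ))
    (P := fun x _ => ExteriorAlgebra.ι ℂ v * x = -(x * ExteriorAlgebra.ι ℂ v))
    (fun w => eq_neg_of_add_eq_zero_left (ExteriorAlgebra.ι_add_mul_swap (R := ℂ) v w))
    (fun x y _ _ hx hy => by rw [mul_add, add_mul, hx, hy, neg_add])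
    (fun a b x _ hx => ?_) x hx
  have hab : CliffordAlgebra.ι _ a * CliffordAlgebra.ι _ b ∈ evenPart L :=
    ι_mul_ι_mem_evenOdd_zero _ a b
  rw [← mul_assoc, ← commute_of_mem_evenPart L hab, mul_assoc, hx, mul_neg, mul_assoc _ x]

open CliffordAlgebra in
theorem mul_eq_neg_mul_of_mem_oddPart {x y : Lam L} (hx : x ∈ oddPart L) (hy : y ∈ oddPart L) :
    x * y = -(y * x) := by
  refine odd_induction (0 : QuadraticForm ℂ (Fin L → ℂ))
    (P := fun x _ => x * y = -(y * x)) (fun v => ι_mul_of_mem_oddPart L v hy)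
    (fun x z _ _ hx hz => by rw [mul_add, add_mul, hx, hz, neg_add])
    (fun a b x _ hx => ?_) x hx
  have hab : CliffordAlgebra.ι _ a * CliffordAlgebra.ι _ b ∈ evenPart L :=
    ι_mul_ι_mem_evenOdd_zero _ a b
  rw [mul_assoc, hx, ← mul_assoc y, ← commute_of_mem_evenPart L hab y, mul_neg, mul_assoc _ y]

/-- The even part of the Grassmann algebra, as a ring. -/
def EvenRing : Type := CliffordAlgebra.even (0 : QuadraticForm ℂ (Fin L → ℂ))

instance : CommRing (EvenRing L) :=
  { (inferInstance : Ring (CliffordAlgebra.even (0 : QuadraticForm ℂ (Fin L → ℂ)))) with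
    mul_comm := fun x y => Subtype.ext (commute_of_mem_evenPart L x.2 y.1) }

/-- The inclusion of the even part. -/
def evenInclusion : EvenRing L →+* Lam L :=
  (CliffordAlgebra.even (0 : QuadraticForm ℂ (Fin L → ℂ))).val.toRingHom

instance : Algebra (EvenRing L) (Lam L) :=
  (evenInclusion L).toAlgebra' fun c x => commute_of_mem_evenPart L c.2 x

theorem algebraMap_mem_evenPart (e : EvenRing L) :
    algebraMap (EvenRing L) (Lam L) e ∈ evenPart L :=
  e.2

theorem exists_algebraMap_eq {x : Lam L} (hx : x ∈ evenPart L) :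
    ∃ e : EvenRing L, algebraMap (EvenRing L) (Lam L) e = x :=
  ⟨⟨x, hx⟩, rfl⟩

theorem isOddPart_oddPart : IsOddPart (EvenRing L) (oddPart L).toAddSubgroup where
  injective := Subtype.val_injective
  even_mul_mem e x hx := by
    have h : algebraMap (EvenRing L) (Lam L) e * x ∈ CliffordAlgebra.evenOdd _ (0 + 1) :=
      SetLike.mul_mem_graded (algebraMap_mem_evenPart L e) hx
    rwa [zero_add] at h
  mul_mem_range {x y} hx hy := exists_algebraMap_eq L
    (SetLike.mul_mem_graded (A := CliffordAlgebra.evenOdd (0 : QuadraticForm ℂ (Fin L → ℂ)))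
      (i := 1) (j := 1) hx hy)
  mul_eq_neg_mul hx hy := mul_eq_neg_mul_of_mem_oddPart L hx hy
  mul_self {x} hx := by
    have h := mul_eq_neg_mul_of_mem_oddPart L hx hx
    have h₂ : (2 : ℂ) • (x * x) = 0 := by rw [two_smul]; exact eq_neg_iff_add_eq_zero.mp h
    exact (smul_eq_zero.mp h₂).resolve_left two_ne_zero

theorem detE_coeMat {k : ℕ} (P : Matrix (Fin k) (Fin k) (EvenRing L)) :
    detE L (coeMat (EvenRing L) (Lam L) P) = algebraMap (EvenRing L) (Lam L) P.det := by
  simp only [detE, Matrix.det_apply, map_sum, Units.smul_def, map_zsmul, ← List.prod_ofFn,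
    map_list_prod, List.map_ofFn]
  rfl

end Grassmann

end Superdeterminant

open Superdeterminant

/-- **Multiplicativity of the superdeterminant.**
Let `M = [[A₁,C₁],[D₁,B₁]]` and `N = [[A₂,C₂],[D₂,B₂]]` be even `(m|n)` supermatrices over `Λ`
whose diagonal blocks are invertible over `Λ_ev`.  The product `MN` has blocks
`[[A₁A₂ + C₁D₂, A₁C₂ + C₁B₂],[D₁A₂ + B₁D₂, D₁C₂ + B₁B₂]]`.  Then the diagonal blocks of `MN`
are invertible over `Λ_ev`, and `sdet(MN) = sdet M · sdet N`, where
`sdet [[A,C],[D,B]] = det A · (det(B − D A⁻¹ C))⁻¹`; all the inverses appearing (quantified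
below) are two-sided inverses, which are unique. -/
theorem sdet_multiplicative (m n : ℕ)
    (A₁ A₂ : Matrix (Fin m) (Fin m) (Lam L)) (B₁ B₂ : Matrix (Fin n) (Fin n) (Lam L))
    (C₁ C₂ : Matrix (Fin m) (Fin n) (Lam L)) (D₁ D₂ : Matrix (Fin n) (Fin m) (Lam L))
    (hA₁ : ∀ i j, A₁ i j ∈ evenPart L) (hB₁ : ∀ i j, B₁ i j ∈ evenPart L)
    (hC₁ : ∀ i j, C₁ i j ∈ oddPart L) (hD₁ : ∀ i j, D₁ i j ∈ oddPart L)
    (hA₂ : ∀ i j, A₂ i j ∈ evenPart L) (hB₂ : ∀ i j, B₂ i j ∈ evenPart L)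
    (hC₂ : ∀ i j, C₂ i j ∈ oddPart L) (hD₂ : ∀ i j, D₂ i j ∈ oddPart L)
    (A₁' : Matrix (Fin m) (Fin m) (Lam L)) (hA₁' : ∀ i j, A₁' i j ∈ evenPart L)
    (hA₁i : A₁ * A₁' = 1 ∧ A₁' * A₁ = 1)
    (B₁' : Matrix (Fin n) (Fin n) (Lam L)) (hB₁' : ∀ i j, B₁' i j ∈ evenPart L)
    (hB₁i : B₁ * B₁' = 1 ∧ B₁' * B₁ = 1)
    (A₂' : Matrix (Fin m) (Fin m) (Lam L)) (hA₂' : ∀ i j, A₂' i j ∈ evenPart L)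
    (hA₂i : A₂ * A₂' = 1 ∧ A₂' * A₂ = 1)
    (B₂' : Matrix (Fin n) (Fin n) (Lam L)) (hB₂' : ∀ i j, B₂' i j ∈ evenPart L)
    (hB₂i : B₂ * B₂' = 1 ∧ B₂' * B₂ = 1) :
    (∃ P : Matrix (Fin m) (Fin m) (Lam L), (∀ i j, P i j ∈ evenPart L) ∧
      (A₁ * A₂ + C₁ * D₂) * P = 1 ∧ P * (A₁ * A₂ + C₁ * D₂) = 1) ∧
    (∃ Q : Matrix (Fin n) (Fin n) (Lam L), (∀ i j, Q i j ∈ evenPart L) ∧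
      (D₁ * C₂ + B₁ * B₂) * Q = 1 ∧ Q * (D₁ * C₂ + B₁ * B₂) = 1) ∧
    ∀ (A₃' : Matrix (Fin m) (Fin m) (Lam L)),
      (A₁ * A₂ + C₁ * D₂) * A₃' = 1 → A₃' * (A₁ * A₂ + C₁ * D₂) = 1 →
      ∀ d₃ d₁ d₂ : Lam L,
        detE L ((D₁ * C₂ + B₁ * B₂)
            - (D₁ * A₂ + B₁ * D₂) * A₃' * (A₁ * C₂ + C₁ * B₂)) * d₃ = 1 →
        d₃ * detE L ((D₁ * C₂ + B₁ * B₂)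
            - (D₁ * A₂ + B₁ * D₂) * A₃' * (A₁ * C₂ + C₁ * B₂)) = 1 →
        detE L (B₁ - D₁ * A₁' * C₁) * d₁ = 1 →
        d₁ * detE L (B₁ - D₁ * A₁' * C₁) = 1 →
        detE L (B₂ - D₂ * A₂' * C₂) * d₂ = 1 →
        d₂ * detE L (B₂ - D₂ * A₂' * C₂) = 1 →
        detE L (A₁ * A₂ + C₁ * D₂) * d₃
          = (detE L A₁ * d₁) * (detE L A₂ * d₂) := by
  have hO := isOddPart_oddPart L
  obtain ⟨a₁, rfl⟩ := exists_coeMat_eq fun i j => exists_algebraMap_eq L (hA₁ i j)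
  obtain ⟨a₂, rfl⟩ := exists_coeMat_eq fun i j => exists_algebraMap_eq L (hA₂ i j)
  obtain ⟨b₁, rfl⟩ := exists_coeMat_eq fun i j => exists_algebraMap_eq L (hB₁ i j)
  obtain ⟨b₂, rfl⟩ := exists_coeMat_eq fun i j => exists_algebraMap_eq L (hB₂ i j)
  obtain ⟨a₁', rfl⟩ := exists_coeMat_eq fun i j => exists_algebraMap_eq L (hA₁' i j)
  obtain ⟨a₂', rfl⟩ := exists_coeMat_eq fun i j => exists_algebraMap_eq L (hA₂' i j)
  obtain ⟨b₁', rfl⟩ := exists_coeMat_eq fun i j => exists_algebraMap_eq L (hB₁' i j)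
  obtain ⟨b₂', rfl⟩ := exists_coeMat_eq fun i j => exists_algebraMap_eq L (hB₂' i j)
  have ha₁ : a₁ * a₁' = 1 := hO.coeMat_injective (by rw [map_mul, map_one]; exact hA₁i.1)
  have ha₂ : a₂ * a₂' = 1 := hO.coeMat_injective (by rw [map_mul, map_one]; exact hA₂i.1)
  have hb₁ : b₁ * b₁' = 1 := hO.coeMat_injective (by rw [map_mul, map_one]; exact hB₁i.1)
  have hb₂ : b₂ * b₂' = 1 := hO.coeMat_injective (by rw [map_mul, map_one]; exact hB₂i.1)
  refine ⟨?_, ?_, ?_⟩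
  · obtain ⟨P, hP, hP'⟩ := hO.exists_inverse_add hC₁ hD₂ ha₁ ha₂
    exact ⟨_, fun i j => algebraMap_mem_evenPart L (P i j), hP, hP'⟩
  · obtain ⟨Q, hQ, hQ'⟩ := hO.exists_inverse_add hD₁ hC₂ hb₁ hb₂
    rw [add_comm] at hQ hQ'
    exact ⟨_, fun i j => algebraMap_mem_evenPart L (Q i j), hQ, hQ'⟩
  · intro A₃' h₃ _ d₃ d₁ d₂ _ hd₃ hd₁ _ hd₂ _
    obtain ⟨A₃, S₁, S₂, S₃, r, eA, e₁, e₂, e₃, hA, hS⟩ :=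
      hO.exists_det_eq (B₁ := b₁) (B₂ := b₂) hC₁ hD₁ hC₂ hD₂ ha₁ ha₂ h₃
    rw [← e₃, detE_coeMat, hS, map_mul, map_mul] at hd₃
    rw [← e₁, detE_coeMat] at hd₁
    rw [← e₂, detE_coeMat] at hd₂
    rw [← eA, detE_coeMat, detE_coeMat, detE_coeMat, hA, map_mul, map_mul]
    have hc := fun e : EvenRing L => Algebra.commutes (A := Lam L) e
    generalize algebraMap (EvenRing L) (Lam L) = φ at *
    have key : φ r * d₃ = d₁ * d₂ := by
      calc φ r * d₃ = d₃ * φ r * ((φ S₁.det * d₁) * (φ S₂.det * d₂)) := by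
            rw [hd₁, hd₂, hc, mul_one, mul_one]
        _ = d₃ * (φ r * φ S₁.det * (d₁ * φ S₂.det)) * d₂ := by simp only [mul_assoc]
        _ = d₃ * (φ S₁.det * φ r * φ S₂.det) * d₁ * d₂ := by
            rw [← hc S₂.det, hc r]; simp only [mul_assoc]
        _ = d₁ * d₂ := by rw [hd₃, one_mul]
    calc φ a₁.det * φ r * φ a₂.det * d₃ = φ a₁.det * (φ r * (φ a₂.det * d₃)) := by
          simp only [mul_assoc]
      _ = φ a₁.det * (φ r * d₃ * φ a₂.det) := by rw [hc a₂.det d₃, mul_assoc (φ r)]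
      _ = φ a₁.det * d₁ * (φ a₂.det * d₂) := by
          rw [key, mul_assoc d₁, ← hc a₂.det d₂, mul_assoc]
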